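/- The x-gradient basis function ψ_I of the 2D double-interpolation element satisfies the interpolation conditions ψ_I(x_A) = 0 for each vertex A ∈ {I, J, K}, ∂ψ_I/∂x(x_I) = 1, ∂ψ_I/∂x(x_J) = 0, ∂ψ_I/∂x(x_K) = 0, and ∂ψ_I/∂y(x_A) = 0 for each A ∈ {I, J, K}. -/

import Mathlib

/-- Derivative of the cubic form defining `ψI` along a curve with area coordinates `u`, `v`, `w`. -/
theorem HasDerivAt.psiForm {u v w : ℝ → ℝ} {u' v' w' t : ℝ} (p q : ℝ)
    (hu : HasDerivAt u u' t) (hv : HasDerivAt v v' t) (hw : HasDerivAt w w' t) :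
    HasDerivAt (fun s => -p * (w s * (u s) ^ 2 + (1 / 2) * u s * v s * w s)
        + q * ((u s) ^ 2 * v s + (1 / 2) * u s * v s * w s))
      (-p * (w' * u t ^ 2 + 2 * w t * u t * u'
          + (1 / 2) * (u' * v t * w t + u t * v' * w t + u t * v t * w'))
        + q * (2 * u t * u' * v t + u t ^ 2 * v'
          + (1 / 2) * (u' * v t * w t + u t * v' * w t + u t * v t * w'))) t := by
  have huvw := ((hu.const_mul (1 / 2)).mul hv).mul hw
  have h := (((hw.mul (hu.pow 2)).add huvw).const_mul (-p)).add
    ((((hu.pow 2).mul hv).add huvw).const_mul q)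
  refine h.congr_deriv ?_
  simp only [Pi.mul_apply, Pi.pow_apply]
  push_cast
  ring

theorem hasDerivAt_areaCoord_left (a b c d x y : ℝ) :
    HasDerivAt (fun s => (a + b * s + c * y) / d) (b / d) x := by
  simpa using ((((hasDerivAt_id x).const_mul b).const_add a).add_const (c * y)).div_const d

theorem hasDerivAt_areaCoord_right (a b c d x y : ℝ) :
    HasDerivAt (fun s => (a + b * x + c * s) / d) (c / d) y := by
  simpa using (((hasDerivAt_id y).const_mul c).const_add (a + b * x)).div_const d

/-- The x-gradient basis function `ψI` of the 2D double-interpolation element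
vanishes at all three vertices, its x-derivative equals the Kronecker delta at
the vertices, and its y-derivative vanishes at all three vertices. -/
theorem dfem2d_psi_interpolation_conditions
    (xI yI xJ yJ xK yK : ℝ)
    (aI bI cI aJ bJ cJ aK bK cK Δ2 : ℝ)
    (haI : aI = xJ * yK - xK * yJ) (hbI : bI = yJ - yK) (hcI : cI = xK - xJ)
    (haJ : aJ = xK * yI - xI * yK) (hbJ : bJ = yK - yI) (hcJ : cJ = xI - xK)
    (haK : aK = xI * yJ - xJ * yI) (hbK : bK = yI - yJ) (hcK : cK = xJ - xI)
    (hΔ : Δ2 = bJ * cK - bK * cJ) (hΔne : Δ2 ≠ 0)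
    (LI LJ LK : ℝ → ℝ → ℝ)
    (hLI : LI = fun x y => (aI + bI * x + cI * y) / Δ2)
    (hLJ : LJ = fun x y => (aJ + bJ * x + cJ * y) / Δ2)
    (hLK : LK = fun x y => (aK + bK * x + cK * y) / Δ2)
    (ψI : ℝ → ℝ → ℝ)
    (hψI : ψI = fun x y =>
      -cJ * (LK x y * (LI x y) ^ 2 + (1 / 2) * LI x y * LJ x y * LK x y)
        + cK * ((LI x y) ^ 2 * LJ x y + (1 / 2) * LI x y * LJ x y * LK x y)) :
    ψI xI yI = 0 ∧ ψI xJ yJ = 0 ∧ ψI xK yK = 0 ∧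
    deriv (fun x => ψI x yI) xI = 1 ∧
    deriv (fun x => ψI x yJ) xJ = 0 ∧
    deriv (fun x => ψI x yK) xK = 0 ∧
    deriv (fun y => ψI xI y) yI = 0 ∧
    deriv (fun y => ψI xJ y) yJ = 0 ∧
    deriv (fun y => ψI xK y) yK = 0 := by
  have hxI (x y : ℝ) : HasDerivAt (fun s => LI s y) (bI / Δ2) x := by
    rw [hLI]
    exact hasDerivAt_areaCoord_left aI bI cI Δ2 x y
  have hxJ (x y : ℝ) : HasDerivAt (fun s => LJ s y) (bJ / Δ2) x := by
    rw [hLJ]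
    exact hasDerivAt_areaCoord_left aJ bJ cJ Δ2 x y
  have hxK (x y : ℝ) : HasDerivAt (fun s => LK s y) (bK / Δ2) x := by
    rw [hLK]
    exact hasDerivAt_areaCoord_left aK bK cK Δ2 x y
  have hyI (x y : ℝ) : HasDerivAt (fun s => LI x s) (cI / Δ2) y := by
    rw [hLI]
    exact hasDerivAt_areaCoord_right aI bI cI Δ2 x y
  have hyJ (x y : ℝ) : HasDerivAt (fun s => LJ x s) (cJ / Δ2) y := by
    rw [hLJ]
    exact hasDerivAt_areaCoord_right aJ bJ cJ Δ2 x y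
  have hyK (x y : ℝ) : HasDerivAt (fun s => LK x s) (cK / Δ2) y := by
    rw [hLK]
    exact hasDerivAt_areaCoord_right aK bK cK Δ2 x y
  have hx (x y : ℝ) := HasDerivAt.psiForm cJ cK (hxI x y) (hxJ x y) (hxK x y)
  have hy (x y : ℝ) := HasDerivAt.psiForm cJ cK (hyI x y) (hyJ x y) (hyK x y)
  subst hψI
  have hII : LI xI yI = 1 := by
    rw [hLI]
    refine (div_eq_one_iff_eq hΔne).2 ?_
    rw [hΔ, haI, hbI, hcI, hbJ, hcK, hbK, hcJ]
    ring
  have hIJ : LI xJ yJ = 0 := by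
    rw [hLI]
    refine div_eq_zero_iff.2 (Or.inl ?_)
    rw [haI, hbI, hcI]
    ring
  have hIK : LI xK yK = 0 := by
    rw [hLI]
    refine div_eq_zero_iff.2 (Or.inl ?_)
    rw [haI, hbI, hcI]
    ring
  have hJI : LJ xI yI = 0 := by
    rw [hLJ]
    refine div_eq_zero_iff.2 (Or.inl ?_)
    rw [haJ, hbJ, hcJ]
    ring
  have hJJ : LJ xJ yJ = 1 := by
    rw [hLJ]
    refine (div_eq_one_iff_eq hΔne).2 ?_
    rw [hΔ, haJ, hbJ, hcJ, hcK, hbK]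
    ring
  have hJK : LJ xK yK = 0 := by
    rw [hLJ]
    refine div_eq_zero_iff.2 (Or.inl ?_)
    rw [haJ, hbJ, hcJ]
    ring
  have hKI : LK xI yI = 0 := by
    rw [hLK]
    refine div_eq_zero_iff.2 (Or.inl ?_)
    rw [haK, hbK, hcK]
    ring
  have hKJ : LK xJ yJ = 0 := by
    rw [hLK]
    refine div_eq_zero_iff.2 (Or.inl ?_)
    rw [haK, hbK, hcK]
    ring
  have hKK : LK xK yK = 1 := by
    rw [hLK]
    refine (div_eq_one_iff_eq hΔne).2 ?_
    rw [hΔ, haK, hbK, hcK, hbJ, hcJ]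
    ring
  refine ⟨?_, ?_, ?_, ?_, ?_, ?_, ?_, ?_, ?_⟩
  · simp [hII, hJI, hKI]
  · simp [hIJ, hJJ, hKJ]
  · simp [hIK, hJK, hKK]
  · refine (hx xI yI).deriv.trans ?_
    rw [hII, hJI, hKI]
    field_simp
    rw [hΔ]
    ring
  · refine (hx xJ yJ).deriv.trans ?_
    simp [hIJ, hKJ]
  · refine (hx xK yK).deriv.trans ?_
    simp [hIK, hJK]
  · refine (hy xI yI).deriv.trans ?_
    rw [hII, hJI, hKI]
    ring
  · refine (hy xJ yJ).deriv.trans ?_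
    simp [hIJ, hKJ]
  · refine (hy xK yK).deriv.trans ?_
    simp [hIK, hJK]
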